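/- LRW transcript consistency (Proposition 7 of the paper): Assume the transcript is collision-free. Then for every i with 1 ≤ i ≤ j, E^{T_j}(x_i ⊕ h(τ_i)) ⊕ h(τ_i) = y_i. -/

import Mathlib

/-- The reprogrammed permutations `E^{T_i}` of the LRW hybrid argument:
`E^{T_0} = E` and
`E^{T_i} = swap(E^{T_{i-1}}(x_i ⊕ h(τ_i)), y_i ⊕ h(τ_i)) ∘ E^{T_{i-1}}`. -/
def lrwReprog {V 𝒯 : Type*} [DecidableEq V] [Add V]
    (E : Equiv.Perm V) (h : 𝒯 → V) (τ : ℕ → 𝒯) (x y : ℕ → V) : ℕ → Equiv.Perm V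
  | 0 => E
  | i + 1 =>
      Equiv.swap (lrwReprog E h τ x y i (x (i + 1) + h (τ (i + 1))))
          (y (i + 1) + h (τ (i + 1))) *
        lrwReprog E h τ x y i

/-- After `m` reprogramming steps of a collision-free transcript, every recorded input
`x_i ⊕ h(τ_i)` with `1 ≤ i ≤ m` is mapped to `y_i ⊕ h(τ_i)`. -/
theorem lrwReprog_apply_of_collisionFree {V 𝒯 : Type*} [DecidableEq V] [Add V]
    (E : Equiv.Perm V) (h : 𝒯 → V) (τ : ℕ → 𝒯) (x y : ℕ → V) (m : ℕ)
    (hx : ∀ a b, 1 ≤ a → a ≤ m → 1 ≤ b → b ≤ m → a ≠ b →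
      x a + h (τ a) ≠ x b + h (τ b))
    (hy : ∀ a b, 1 ≤ a → a ≤ m → 1 ≤ b → b ≤ m → a ≠ b →
      y a + h (τ a) ≠ y b + h (τ b))
    (i : ℕ) (hi : 1 ≤ i) (him : i ≤ m) :
    lrwReprog E h τ x y m (x i + h (τ i)) = y i + h (τ i) := by
  induction m with
  | zero => omega
  | succ k ih =>
    rw [lrwReprog, Equiv.Perm.mul_apply]
    rcases him.eq_or_lt with rfl | hlt
    · exact Equiv.swap_apply_left _ _
    · have hik : lrwReprog E h τ x y k (x i + h (τ i)) = y i + h (τ i) :=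
        ih (fun a b ha hak hb hbk => hx a b ha (by omega) hb (by omega))
          (fun a b ha hak hb hbk => hy a b ha (by omega) hb (by omega)) (by omega)
      rw [Equiv.swap_apply_of_ne_of_ne, hik]
      · exact (lrwReprog E h τ x y k).injective.ne
          (hx i (k + 1) hi him (by omega) le_rfl hlt.ne)
      · rw [hik]
        exact hy i (k + 1) hi him (by omega) le_rfl hlt.ne

/-- LRW transcript consistency (Proposition 7): if the transcript is collision-free
(the values `x_i ⊕ h(τ_i)` are pairwise distinct and the values `y_i ⊕ h(τ_i)` are
pairwise distinct), then `E^{T_j}(x_i ⊕ h(τ_i)) ⊕ h(τ_i) = y_i` for all `1 ≤ i ≤ j`. -/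
theorem lrw_transcript_consistency {n j : ℕ} (hn : 1 ≤ n) {𝒯 : Type*}
    (E : Equiv.Perm (Fin n → ZMod 2)) (h : 𝒯 → Fin n → ZMod 2)
    (τ : ℕ → 𝒯) (x y : ℕ → Fin n → ZMod 2)
    (hx : ∀ a b, 1 ≤ a → a ≤ j → 1 ≤ b → b ≤ j → a ≠ b →
      x a + h (τ a) ≠ x b + h (τ b))
    (hy : ∀ a b, 1 ≤ a → a ≤ j → 1 ≤ b → b ≤ j → a ≠ b →
      y a + h (τ a) ≠ y b + h (τ b))
    (i : ℕ) (hi1 : 1 ≤ i) (hij : i ≤ j) :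
    lrwReprog E h τ x y j (x i + h (τ i)) + h (τ i) = y i := by
  rw [lrwReprog_apply_of_collisionFree E h τ x y j hx hy i hi1 hij, add_assoc,
    show h (τ i) + h (τ i) = 0 from funext fun _ => CharTwo.add_self_eq_zero _, add_zero]
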